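/- Let k ≥ 2 be an integer and set κ = 2^{k−1}. For every ε > 0 there exists a constant C(ε,k) > 0 depending only on ε and k such that for all positive integers Q and N, M_k(Q,N) ≤ C(ε,k) · ( Q^{k+1}/N + ( Q^{(κ−1)/κ} + Q^{(κ+k)/κ} / N^{1/κ} ) · N^ε ), where M_k(Q,N) = max over x' ∈ S_{Q,k} of the number of x ∈ S_{Q,k} with ‖x − x'‖ < 1/(2N). -/

import Mathlib

open Finset Real
open scoped Classical

noncomputable def dist01 (x : ℝ) : ℝ := |x - round x|

noncomputable def SQk (Q k : ℕ) : Finset ℚ :=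
  (Finset.Ioc Q (2*Q)).biUnion fun q =>
    ((Finset.Ico 1 (q^k)).filter fun a => Nat.gcd a q = 1).image fun a => (a : ℚ) / (q : ℚ)^k

noncomputable def MQNk (Q N k : ℕ) : ℕ :=
  (SQk Q k).sup fun x' => ((SQk Q k).filter fun x => dist01 ((x : ℝ) - (x' : ℝ)) < 1/(2*N)).card


lemma mem_do {α β : Type} (s : Finset α) (f : α → β) (y : β) :
    (y ∈ (do let a ← s; pure (f a) : Finset β)) ↔ ∃ a ∈ s, f a = y := by
  simp only [Finset.bind_def, Finset.pure_def, Finset.mem_sup, Finset.mem_singleton]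
  constructor
  · rintro ⟨a, ha, h⟩; exact ⟨a, ha, h.symm⟩
  · rintro ⟨a, ha, h⟩; exact ⟨a, ha, h.symm⟩

lemma mem_SQk (Q k : ℕ) (x : ℚ) : x ∈ SQk Q k ↔ ∃ q ∈ Finset.Ioc Q (2*Q), ∃ a ∈ Finset.Ico 1 (q^k),
    Nat.gcd a q = 1 ∧ (a:ℚ)/(q:ℚ)^k = x := by
  unfold SQk
  simp only [Finset.mem_biUnion, Finset.mem_image, mem_do, Finset.mem_filter]
  constructor
  · rintro ⟨q, hq, b, ⟨a, ⟨h1, h2⟩, rfl⟩, h3⟩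
    exact ⟨q, hq, a, h1, h2, h3⟩
  · rintro ⟨q, hq, a, h1, h2, h3⟩
    exact ⟨q, hq, a, ⟨a, ⟨h1, h2⟩, rfl⟩, h3⟩

lemma MQNk_le (Q N k : ℕ) (b : ℕ) (hb : ∀ x' ∈ SQk Q k,
    ((SQk Q k).filter (fun x : ℚ => dist01 ((x:ℝ) - (x':ℝ)) < 1/(2*(N:ℝ)))).card ≤ b) :
    MQNk Q N k ≤ b := by
  unfold MQNk
  apply Finset.sup_le
  intro x' hx'
  refine le_trans ?_ (hb x' hx')
  refine le_trans (Finset.card_le_card (t := ((SQk Q k).filter (fun x : ℚ => dist01 ((x:ℝ) - (x':ℝ)) <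
    1/(2*(N:ℝ)))).image (fun x : ℚ => (x:ℝ))) ?_) Finset.card_image_le
  intro y hy
  simp only [Finset.mem_filter, mem_do] at hy
  obtain ⟨⟨a, ha, rfl⟩, h⟩ := hy
  exact Finset.mem_image.mpr ⟨a, Finset.mem_filter.mpr ⟨ha, h⟩, rfl⟩

lemma prime_pow_bound (η : ℝ) (hη : 0 < η) : ∃ (c : ℝ) (K : ℕ), 1 ≤ c ∧ ∀ p a : ℕ, p.Prime →
    ((a:ℝ) + 1) ≤ (if p < K then c else 1) * ((p:ℝ)^a) ^ η := by
  refine ⟨max 1 (1 / (η * Real.log 2)), ⌈(2:ℝ)^(1/η)⌉₊, le_max_left _ _, ?_⟩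
  intro p a hp
  have hp2 : (2:ℝ) ≤ p := by exact_mod_cast hp.two_le
  have hl : 0 < Real.log 2 := Real.log_pos (by norm_num)
  have hcomm : ((p:ℝ)^a) ^ η = ((p:ℝ)^η)^a := by
    rw [← Real.rpow_natCast, ← Real.rpow_mul (by positivity), mul_comm, Real.rpow_mul (by positivity),
      Real.rpow_natCast]
  split_ifs with h
  · set c := max 1 (1 / (η * Real.log 2)) with hc
    have h1 : (1:ℝ) ≤ c := le_max_left _ _
    have h2 : 1 ≤ c * (η * Real.log 2) := by
      have : 1 / (η * Real.log 2) ≤ c := le_max_right _ _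
      rwa [div_le_iff₀ (by positivity)] at this
    have h3 : 1 + a * (η * Real.log 2) ≤ ((p:ℝ)^a) ^ η := by
      calc 1 + a * (η * Real.log 2) ≤ Real.exp (a * (η * Real.log 2)) := by
            linarith [Real.add_one_le_exp (a * (η * Real.log 2))]
        _ = ((2:ℝ)^a)^η := by
            rw [Real.rpow_def_of_pos (by positivity), Real.log_pow]; ring_nf
        _ ≤ _ := by gcongr
    have ha : (0:ℝ) ≤ a := by positivity
    calc (a:ℝ) + 1 ≤ c * (1 + a * (η * Real.log 2)) := by nlinarith
      _ ≤ _ := by gcongr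
  · rw [one_mul, hcomm]
    have h1 : (2:ℝ) ≤ (p:ℝ)^η := by
      have : (2:ℝ)^(1/η) ≤ p := (Nat.le_ceil _).trans (by exact_mod_cast not_lt.mp h)
      calc (2:ℝ) = ((2:ℝ)^(1/η))^η := by
            rw [← Real.rpow_mul (by norm_num)]; field_simp; simp
        _ ≤ _ := by gcongr
    calc (a:ℝ) + 1 ≤ 2^a := by exact_mod_cast Nat.lt_two_pow_self
      _ ≤ _ := by gcongr

lemma divisor_bound (η : ℝ) (hη : 0 < η) : ∃ C : ℝ, 1 ≤ C ∧ ∀ n : ℕ, n ≠ 0 →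
    (n.divisors.card : ℝ) ≤ C * (n:ℝ)^η := by
  obtain ⟨c, K, hc, h⟩ := prime_pow_bound η hη
  have key : ∀ n : ℕ, n ≠ 0 →
      (n.divisors.card : ℝ) ≤ c^(n.primeFactors.filter (· < K)).card * (n:ℝ)^η := by
    intro n
    induction n using Nat.recOnPosPrimePosCoprime with
    | zero => simp
    | one => simp
    | prime_pow p a hp ha =>
      intro _
      have := h p a hp
      rw [Nat.divisors_prime_pow hp, Nat.primeFactors_prime_pow ha.ne' hp]
      simp only [card_map, card_range, Finset.filter_singleton]
      push_cast
      split_ifs at this ⊢ <;> simpa using this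
    | coprime a b ha hb hab iha ihb =>
      intro _
      rw [hab.card_divisors_mul, hab.primeFactors_mul, Finset.filter_union, Finset.card_union_of_disjoint
        (Finset.disjoint_filter_filter hab.disjoint_primeFactors)]
      push_cast
      rw [Real.mul_rpow (by positivity) (by positivity), pow_add]
      have := mul_le_mul (iha (by omega)) (ihb (by omega)) (by positivity) (by positivity)
      linarith
  refine ⟨c^K, one_le_pow₀ hc, fun n hn => (key n hn).trans ?_⟩
  gcongr
  · calc _ ≤ (Finset.range K).card := by
          apply Finset.card_le_card
          intro x hx
          simpa using (Finset.mem_filter.mp hx).2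
      _ = K := by simp

def shf (A : Finset ℤ) (h : ℤ) : Finset ℤ := A.filter (fun x => x + h ∈ A)

noncomputable def WW (I : Finset ℤ) : ℕ → Polynomial ℤ → Finset ℤ → ℤ → ℕ
  | 0, f, A, n => (A.filter (fun x => f.eval x = n)).card
  | j+1, f, A, n => ∑ h ∈ I.erase 0, WW I j (Polynomial.taylor h f - f) (shf A h) n

noncomputable def TT (I : Finset ℤ) : ℕ → Finset ℤ → ℕ
  | 0, A => A.card
  | j+1, A => ∑ h ∈ I.erase 0, TT I j (shf A h)

lemma shf_subset (A : Finset ℤ) (h : ℤ) : shf A h ⊆ A := Finset.filter_subset _ _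

lemma sum_shf (I A : Finset ℤ) (hI : ∀ x ∈ A, ∀ y ∈ A, y - x ∈ I) :
    ∑ h ∈ I, (shf A h).card = A.card ^ 2 := by
  rw [sq, ← Finset.card_product, Finset.card_eq_sum_card_fiberwise (f := fun p : ℤ × ℤ => p.2 - p.1) (t := I)]
  · apply Finset.sum_congr rfl
    intro h _
    apply Finset.card_bij (fun x _ => (x, x + h))
    · intro a ha
      simp only [shf, Finset.mem_filter] at ha
      simp [ha]
    · intro a _ b _ hab
      simpa using congrArg Prod.fst hab
    · rintro ⟨x, y⟩ hb
      simp only [Finset.mem_filter, Finset.mem_product] at hb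
      have : y = x + h := by omega
      subst this
      exact ⟨x, by simp [shf, hb.1], rfl⟩
  · rintro ⟨x, y⟩ hp
    simp only [Finset.coe_product, Set.mem_prod, Finset.mem_coe] at hp
    exact hI x hp.1 y hp.2

lemma diff_bound (I : Finset ℤ) (L : ℕ) (hL : I.card ≤ L) (j : ℕ) :
    ∀ A : Finset ℤ, A.card ≤ L → (∀ x ∈ A, ∀ y ∈ A, y - x ∈ I) →
      A.card^(2^j) * L^(j+1) ≤ j * L^(2^j+j) + L^(2^j) * TT I j A := by
  induction j with
  | zero => intro A _ _; simp [TT, mul_comm]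
  | succ j ih =>
    intro A hA hI
    have hstep : ∀ h : ℤ, (shf A h).card^(2^j) * L^(j+1) ≤
        j * L^(2^j+j) + L^(2^j) * TT I j (shf A h) := fun h => ih _
      ((Finset.card_le_card (shf_subset A h)).trans hA)
      (fun x hx y hy => hI x (shf_subset A h hx) y (shf_subset A h hy))
    rcases A.eq_empty_or_nonempty with rfl | ⟨x0, hx0⟩
    · simp
    have h0 : (0:ℤ) ∈ I := by simpa using hI x0 hx0 x0 hx0
    obtain ⟨m, hm⟩ : ∃ m, 2^j = m+1 := ⟨2^j-1, by have := Nat.two_pow_pos j; omega⟩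
    have hpm : (∑ h ∈ I, (shf A h).card)^(2^j) ≤ L^m * ∑ h ∈ I, (shf A h).card^(2^j) := by
      rw [hm]
      refine (pow_sum_le_card_mul_sum_pow (fun i _ => Nat.zero_le _) m).trans ?_
      gcongr
      simpa using hL
    have hsum : ∑ h ∈ I, (shf A h).card^(2^j) * L^(j+1) ≤
        L^(2^j) * L^(j+1) + (L * (j * L^(2^j+j)) + L^(2^j) * TT I (j+1) A) := by
      rw [← Finset.add_sum_erase _ _ h0]
      apply add_le_add
      · gcongr
        exact (Finset.card_le_card (shf_subset A 0)).trans hA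
      · refine (Finset.sum_le_sum (fun h _ => hstep h)).trans ?_
        rw [Finset.sum_add_distrib, Finset.sum_const, ← Finset.mul_sum, TT, smul_eq_mul]
        apply Nat.add_le_add_right
        gcongr
        exact (Finset.card_le_card (Finset.erase_subset _ _)).trans hL
    calc A.card^(2^(j+1)) * L^(j+1+1) = (A.card^2)^(2^j) * L^(j+1) * L := by
          rw [← pow_mul, pow_succ 2 j, mul_comm 2, pow_succ L (j+1), mul_assoc]
      _ = (∑ h ∈ I, (shf A h).card)^(2^j) * L^(j+1) * L := by rw [sum_shf I A hI]
      _ ≤ (L^m * ∑ h ∈ I, (shf A h).card^(2^j)) * L^(j+1) * L := by gcongr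
      _ = L^(2^j) * ∑ h ∈ I, (shf A h).card^(2^j) * L^(j+1) := by
          rw [← Finset.sum_mul, hm]; ring
      _ ≤ L^(2^j) * (L^(2^j) * L^(j+1) + (L * (j * L^(2^j+j)) + L^(2^j) * TT I (j+1) A)) := by gcongr
      _ = _ := by rw [pow_succ 2 j]; push_cast; ring

lemma TT_le (I : Finset ℤ) (S : ℕ → Finset ℤ) (hS : ∀ i, ∀ a ∈ S i, ∀ b ∈ S i, a - b ∈ S (i+1))
    (j : ℕ) : ∀ (i : ℕ) (f : Polynomial ℤ) (A : Finset ℤ), (∀ x ∈ A, f.eval x ∈ S i) →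
      TT I j A ≤ ∑ n ∈ S (i+j), WW I j f A n := by
  induction j with
  | zero =>
    intro i f A hA
    simp only [TT, WW, add_zero]
    exact (Finset.card_eq_sum_card_fiberwise hA).le
  | succ j ih =>
    intro i f A hA
    simp only [TT, WW]
    rw [Finset.sum_comm]
    apply Finset.sum_le_sum
    intro h _
    have := ih (i+1) (Polynomial.taylor h f - f) (shf A h) ?_
    · rwa [show i + (j+1) = i + 1 + j by ring]
    · intro x hx
      simp only [shf, Finset.mem_filter] at hx
      rw [Polynomial.eval_sub, Polynomial.taylor_eval]
      exact hS i _ (hA _ hx.2) _ (hA _ hx.1)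

open Polynomial in
lemma natDegree_diff (f : Polynomial ℤ) (d : ℕ) (hf : f.natDegree = d+1) (h : ℤ) (hh : h ≠ 0) :
    (taylor h f - f).natDegree = d := by
  have hlead : f.coeff (d+1) ≠ 0 := by
    rw [← hf]; intro h0
    rw [coeff_natDegree, leadingCoeff_eq_zero] at h0
    simp [h0] at hf
  have hd : (taylor h f).natDegree = d+1 := by rw [natDegree_taylor, hf]
  apply le_antisymm
  · rw [natDegree_le_iff_coeff_eq_zero]
    intro N hN
    rw [coeff_sub]
    rcases Nat.lt_or_ge (d+1) N with h1 | h1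
    · rw [coeff_eq_zero_of_natDegree_lt (by omega), coeff_eq_zero_of_natDegree_lt (by omega), sub_zero]
    · have : N = d+1 := by omega
      subst this
      have := coeff_taylor_natDegree (r := h) (f := f)
      rw [hf] at this
      rw [this, leadingCoeff, hf, sub_self]
  · apply le_natDegree_of_ne_zero
    have h1 : (hasseDeriv d f).natDegree ≤ 1 := (natDegree_hasseDeriv_le f d).trans (by omega)
    rw [coeff_sub, taylor_coeff, eq_X_add_C_of_natDegree_le_one h1]
    simp only [hasseDeriv_coeff, eval_add, eval_mul, eval_C, eval_X, zero_add, Nat.choose_self,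
      Nat.cast_one, one_mul, add_sub_cancel_right]
    have : ((1 + d).choose d : ℤ) ≠ 0 := by
      exact_mod_cast (Nat.choose_pos (by omega)).ne'
    rw [add_comm 1 d] at *
    exact mul_ne_zero (mul_ne_zero this hlead) hh

lemma linear_card (f : Polynomial ℤ) (hf : f.natDegree = 1) (A : Finset ℤ) (n : ℤ) :
    (A.filter (fun x => f.eval x = n)).card ≤ 1 := by
  rw [Finset.card_le_one]
  intro x hx y hy
  simp only [Finset.mem_filter] at hx hy
  have hc : f.coeff 1 ≠ 0 := by
    rw [← hf]; intro h0
    rw [Polynomial.coeff_natDegree, Polynomial.leadingCoeff_eq_zero] at h0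
    simp [h0] at hf
  have h := hx.2.trans hy.2.symm
  rw [Polynomial.eq_X_add_C_of_natDegree_le_one hf.le] at h
  simp only [Polynomial.eval_add, Polynomial.eval_mul, Polynomial.eval_C, Polynomial.eval_X,
    add_left_inj] at h
  exact mul_left_cancel₀ hc h

lemma WW_le_pow (I : Finset ℤ) (L : ℕ) (hL : I.card ≤ L) (j : ℕ) : ∀ (f : Polynomial ℤ)
    (A : Finset ℤ) (n : ℤ), f.natDegree = j+1 → WW I j f A n ≤ L^j := by
  induction j with
  | zero => intro f A n hf; simpa [WW] using linear_card f (by simpa using hf) A n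
  | succ j ih =>
    intro f A n hf
    rw [WW]
    refine (Finset.sum_le_card_nsmul _ _ (L^j) ?_).trans ?_
    · intro h hh
      exact ih _ _ _ (natDegree_diff f _ hf h (Finset.ne_of_mem_erase hh))
    · rw [smul_eq_mul, pow_succ, mul_comm]
      gcongr
      exact (Finset.card_le_card (Finset.erase_subset _ _)).trans hL

lemma WW_dvd (I : Finset ℤ) (m : ℤ) (n : ℤ) (hmn : ¬ m ∣ n) (j : ℕ) : ∀ (f : Polynomial ℤ)
    (A : Finset ℤ), (∀ x, m ∣ f.eval x) → WW I j f A n = 0 := by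
  induction j with
  | zero =>
    intro f A hf
    rw [WW, Finset.card_eq_zero, Finset.filter_eq_empty_iff]
    rintro x _ rfl
    exact hmn (hf x)
  | succ j ih =>
    intro f A hf
    rw [WW]
    apply Finset.sum_eq_zero
    intro h _
    apply ih
    intro x
    rw [Polynomial.eval_sub, Polynomial.taylor_eval]
    exact dvd_sub (hf _) (hf _)

lemma card_int_dvd (I : Finset ℤ) (n : ℤ) (hn : n ≠ 0) :
    (I.filter (fun h => h ∣ n)).card ≤ 2 * n.natAbs.divisors.card := by
  calc _ ≤ (n.natAbs.divisors.image (fun d : ℕ => (d:ℤ)) ∪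
            n.natAbs.divisors.image (fun d : ℕ => -(d:ℤ))).card := by
        apply Finset.card_le_card
        intro h hh
        have hd := (Finset.mem_filter.mp hh).2
        have hm : h.natAbs ∈ n.natAbs.divisors :=
          Nat.mem_divisors.mpr ⟨Int.natAbs_dvd_natAbs.mpr hd, by simpa using hn⟩
        simp only [Finset.mem_union, Finset.mem_image]
        rcases le_total 0 h with h0 | h0
        · left; exact ⟨_, hm, by omega⟩
        · right; exact ⟨_, hm, by omega⟩
    _ ≤ _ := (Finset.card_union_le _ _).trans (by
        rw [two_mul]; exact add_le_add Finset.card_image_le Finset.card_image_le)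

lemma WW_le_div (I : Finset ℤ) (n : ℤ) (hn : n ≠ 0) (j : ℕ) : ∀ (f : Polynomial ℤ)
    (A : Finset ℤ), f.natDegree = j+1 → WW I j f A n ≤ (2 * n.natAbs.divisors.card)^j := by
  induction j with
  | zero => intro f A hf; simpa [WW] using linear_card f (by simpa using hf) A n
  | succ j ih =>
    intro f A hf
    rw [WW, ← Finset.sum_filter_of_ne (p := fun h => h ∣ n)]
    · refine (Finset.sum_le_card_nsmul _ _ ((2 * n.natAbs.divisors.card)^j) ?_).trans ?_
      · intro h hh
        exact ih _ _ (natDegree_diff f _ hf h (Finset.ne_of_mem_erase (Finset.mem_filter.mp hh).1))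
      · rw [smul_eq_mul, pow_succ, mul_comm]
        gcongr
        exact card_int_dvd _ n hn
    · intro h _ hne
      by_contra hnd
      apply hne
      apply WW_dvd I h n hnd
      intro x
      rw [Polynomial.eval_sub, Polynomial.taylor_eval]
      have := Polynomial.sub_dvd_eval_sub (x + h) x f
      simpa using this

/-- Combined differencing inequality. -/
lemma weyl_count (I : Finset ℤ) (L : ℕ) (hL : I.card ≤ L) (S : ℕ → Finset ℤ)
    (hS : ∀ i, ∀ a ∈ S i, ∀ b ∈ S i, a - b ∈ S (i+1)) (j : ℕ) (f : Polynomial ℤ)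
    (hf : f.natDegree = j+1) (A : Finset ℤ) (hAL : A.card ≤ L)
    (hI : ∀ x ∈ A, ∀ y ∈ A, y - x ∈ I) (hA : ∀ x ∈ A, f.eval x ∈ S 0) (D : ℝ) (hD : 0 ≤ D)
    (hdiv : ∀ n ∈ S j, n ≠ 0 → ((2 * n.natAbs.divisors.card : ℕ) : ℝ)^j ≤ D) :
    (A.card : ℝ)^(2^j) * (L:ℝ)^(j+1) ≤ (j+1) * (L:ℝ)^(2^j+j) + (L:ℝ)^(2^j) * ((S j).card * D) := by
  have h1 := diff_bound I L hL j A hAL hI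
  have h2 := TT_le I S hS j 0 f A hA
  rw [zero_add] at h2
  have h3 : ((∑ n ∈ S j, WW I j f A n : ℕ) : ℝ) ≤ L^j + (S j).card * D := by
    push_cast
    calc ∑ n ∈ S j, (WW I j f A n : ℝ) ≤ ∑ n ∈ S j, ((if n = 0 then (L:ℝ)^j else 0) + D) := by
          apply Finset.sum_le_sum
          intro n hn
          split_ifs with h0
          · have := WW_le_pow I L hL j f A n hf
            have : (WW I j f A n : ℝ) ≤ (L:ℝ)^j := by exact_mod_cast this
            linarith
          · have := WW_le_div I n h0 j f A hf
            have : (WW I j f A n : ℝ) ≤ ((2 * n.natAbs.divisors.card : ℕ) : ℝ)^j := by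
              exact_mod_cast this
            linarith [hdiv n hn h0]
      _ ≤ _ := by
          rw [Finset.sum_add_distrib, Finset.sum_ite_eq', Finset.sum_const, nsmul_eq_mul]
          gcongr
          split_ifs
          · exact le_rfl
          · positivity
  have h1' : (A.card : ℝ)^(2^j) * (L:ℝ)^(j+1) ≤ j * (L:ℝ)^(2^j+j) + (L:ℝ)^(2^j) * TT I j A := by
    exact_mod_cast h1
  have h2' : (TT I j A : ℝ) ≤ L^j + (S j).card * D := le_trans (by exact_mod_cast h2) h3
  calc _ ≤ _ := h1'
    _ ≤ j * (L:ℝ)^(2^j+j) + (L:ℝ)^(2^j) * (L^j + (S j).card * D) := by gcongr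
    _ = _ := by ring

lemma S_card (r a K : ℕ) (hr : 0 < r) (har : Nat.Coprime a r) (B : ℤ) (hB : B ≤ K * r) (δ : ℝ)
    (hδ : 0 ≤ δ) :
    (((Finset.Icc (-B) B).filter (fun n : ℤ => ∃ m : ℤ, |(a:ℝ)/r * n - m| < δ)).card : ℝ) ≤
      (2 * K + 1) * (2 * (δ * r) + 1) := by
  set S := (Finset.Icc (-B) B).filter (fun n : ℤ => ∃ m : ℤ, |(a:ℝ)/r * n - m| < δ) with hS
  have hex : ∀ n : ℤ, ∃ m : ℤ, n ∈ S → |(a:ℝ)/r * n - m| < δ := by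
    intro n
    by_cases hn : n ∈ S
    · obtain ⟨m, hm⟩ := (Finset.mem_filter.mp hn).2
      exact ⟨m, fun _ => hm⟩
    · exact ⟨0, fun h => absurd h hn⟩
  choose g hg using hex
  have hrR : (0:ℝ) < r := by exact_mod_cast hr
  have hrZ : (0:ℤ) < r := by exact_mod_cast hr
  set T : ℤ := ⌊δ * r⌋ with hT
  have hT0 : 0 ≤ T := Int.floor_nonneg.mpr (by positivity)
  have hcard : S.card ≤ ((Finset.Icc (-(K:ℤ)) K) ×ˢ (Finset.Icc (-T) T)).card := by
    apply Finset.card_le_card_of_injOn (fun n => (n / (r:ℤ), a * n - r * g n))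
    · intro n hn
      have hn' : n ∈ S := hn
      have hb := Finset.mem_Icc.mp (Finset.mem_filter.mp hn').1
      simp only [Finset.coe_product, Set.mem_prod, Finset.mem_coe, Finset.mem_Icc]
      refine ⟨⟨?_, ?_⟩, ?_⟩
      · rw [Int.le_ediv_iff_mul_le hrZ]; linarith
      · apply Int.ediv_le_of_le_mul hrZ; linarith
      · rw [← abs_le, hT, Int.le_floor]
        have h1 := hg n hn'
        push_cast
        have h2 : ((a:ℝ) * n - r * g n) = ((a:ℝ)/r * n - g n) * r := by field_simp
        rw [h2, abs_mul, abs_of_pos hrR]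
        gcongr
    · intro n hn n' hn' heq
      simp only [Prod.mk.injEq] at heq
      obtain ⟨h1, h2⟩ := heq
      have h3 : (r:ℤ) ∣ (a:ℤ) * (n - n') := ⟨g n - g n', by linarith⟩
      have h4 : (r:ℤ) ∣ n - n' := by
        apply IsCoprime.dvd_of_dvd_mul_left _ h3
        exact (Nat.isCoprime_iff_coprime.mpr har).symm
      have h5 : n' % r = n % r := (Int.emod_emod_of_dvd n' dvd_rfl).symm.trans (by
        rw [Int.emod_emod_of_dvd n' dvd_rfl]
        exact (Int.modEq_iff_dvd.mpr h4))
      rw [← Int.mul_ediv_add_emod n r, ← Int.mul_ediv_add_emod n' r, h1, h5]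
  rw [Finset.card_product, Int.card_Icc, Int.card_Icc] at hcard
  have e1 : (((K:ℤ) + 1 - -(K:ℤ)).toNat : ℝ) = 2 * K + 1 := by
    have : ((K:ℤ) + 1 - -(K:ℤ)).toNat = 2 * K + 1 := by omega
    rw [this]; push_cast; ring
  have e2 : ((T + 1 - -T).toNat : ℝ) ≤ 2 * (δ * r) + 1 := by
    have : (((T + 1 - -T).toNat : ℤ) : ℝ) = 2 * T + 1 := by
      rw [Int.toNat_of_nonneg (by omega)]; push_cast; ring
    have h' : (T:ℝ) ≤ δ * r := Int.floor_le _
    have h'' : ((T + 1 - -T).toNat : ℝ) = 2 * T + 1 := by exact_mod_cast this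
    linarith
  calc (S.card : ℝ) ≤ (((K:ℤ) + 1 - -(K:ℤ)).toNat : ℝ) * ((T + 1 - -T).toNat : ℝ) := by
        exact_mod_cast hcard
    _ ≤ _ := by rw [e1]; gcongr

lemma perq_card (R : ℕ) (x' w : ℝ) (hw : 0 ≤ w) (h0 : 0 ≤ x') (h1 : x' ≤ 1) :
    (((Finset.Ico 1 R).filter (fun a : ℕ => dist01 ((a:ℝ)/R - x') < w)).card : ℝ) ≤
      3 * (2 * (w * R) + 1) := by
  rcases Nat.eq_zero_or_pos R with rfl | hR
  · simp
  have hRR : (0:ℝ) < R := by exact_mod_cast hR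
  set lo : ℤ → ℤ := fun m => ⌈(x' + m) * R - w * R⌉
  set hi : ℤ → ℤ := fun m => ⌊(x' + m) * R + w * R⌋
  set F := (Finset.Ico 1 R).filter (fun a : ℕ => dist01 ((a:ℝ)/R - x') < w)
  have hsub : F.image (fun a : ℕ => (a:ℤ)) ⊆
      (Finset.Icc (-1:ℤ) 1).biUnion (fun m => Finset.Icc (lo m) (hi m)) := by
    intro z hz
    obtain ⟨a, ha, rfl⟩ := Finset.mem_image.mp hz
    obtain ⟨ha1, ha2⟩ := Finset.mem_filter.mp ha
    have ha3 := Finset.mem_Ico.mp ha1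
    have hge : (0:ℝ) ≤ (a:ℝ)/R := by positivity
    have hle : (a:ℝ)/R ≤ 1 := by
      rw [div_le_one hRR]; exact_mod_cast ha3.2.le
    rw [Finset.mem_biUnion]
    refine ⟨round ((a:ℝ)/R - x'), ?_, ?_⟩
    · rw [Finset.mem_Icc, round_eq]
      constructor
      · rw [Int.le_floor]; push_cast; linarith
      · rw [← Int.lt_add_one_iff, Int.floor_lt]; push_cast; linarith
    · set m := round ((a:ℝ)/R - x')
      have ha4 : |(a:ℝ)/R - x' - m| < w := ha2
      rw [abs_lt] at ha4
      have ea : (a:ℝ) = (a:ℝ)/R * R := by field_simp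
      rw [Finset.mem_Icc, Int.ceil_le, Int.le_floor]
      push_cast
      constructor
      · rw [ea]; nlinarith [ha4.1]
      · rw [ea]; nlinarith [ha4.2]
  have hc1 : F.card ≤ ∑ m ∈ Finset.Icc (-1:ℤ) 1, (Finset.Icc (lo m) (hi m)).card := by
    rw [← Finset.card_image_of_injective F (Nat.cast_injective (R := ℤ))]
    exact (Finset.card_le_card hsub).trans Finset.card_biUnion_le
  calc (F.card : ℝ) ≤ ∑ m ∈ Finset.Icc (-1:ℤ) 1, ((Finset.Icc (lo m) (hi m)).card : ℝ) := by
        exact_mod_cast hc1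
    _ ≤ ∑ m ∈ Finset.Icc (-1:ℤ) 1, (2 * (w * R) + 1) := by
        apply Finset.sum_le_sum
        intro m _
        rw [Int.card_Icc]
        have hh : (hi m : ℝ) ≤ (x' + m) * R + w * R := Int.floor_le _
        have hl : (x' + m) * R - w * R ≤ (lo m : ℝ) := Int.le_ceil _
        rcases le_total 0 (hi m + 1 - lo m) with hp | hp
        · have : (((hi m + 1 - lo m).toNat : ℤ) : ℝ) = hi m + 1 - lo m := by
            rw [Int.toNat_of_nonneg hp]; push_cast; ring
          have h'' : ((hi m + 1 - lo m).toNat : ℝ) = hi m + 1 - lo m := by exact_mod_cast this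
          linarith
        · rw [Int.toNat_of_nonpos hp]; push_cast; positivity
    _ = _ := by simp; ring

noncomputable def AA (Q k : ℕ) (x' δ : ℝ) : Finset ℕ :=
  (Finset.Ioc Q (2*Q)).filter (fun q => ∃ m : ℤ, |x' * (q:ℝ)^k - m| < δ)

lemma count_le (Q N k : ℕ) (hN : 0 < N) (x' : ℝ) (h0 : 0 ≤ x') (h1 : x' ≤ 1) :
    (((SQk Q k).filter fun x : ℚ => dist01 ((x : ℝ) - x') < 1/(2*N)).card : ℝ) ≤
      (AA Q k x' ((2*Q:ℝ)^k/(2*N))).card * (3 * (2 * ((2*Q:ℝ)^k/(2*N)) + 1)) := by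
  set δ := ((2*Q:ℝ)^k/(2*N))
  have hNR : (0:ℝ) < N := by exact_mod_cast hN
  set w : ℝ := 1/(2*N)
  have hw : 0 < w := by positivity
  set G : ℕ → Finset ℕ := fun q => (Finset.Ico 1 (q^k)).filter
    (fun a : ℕ => dist01 ((a:ℝ)/(q^k : ℕ) - x') < w)
  have hsub : ((SQk Q k).filter fun x : ℚ => dist01 ((x : ℝ) - x') < w) ⊆
      (AA Q k x' δ).biUnion (fun q => (G q).image (fun a : ℕ => (a : ℚ) / (q : ℚ)^k)) := by
    intro x hx
    obtain ⟨hx1, hx2⟩ := Finset.mem_filter.mp hx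
    obtain ⟨q, hq, a, ha1, _, rfl⟩ := (mem_SQk _ _ _).mp hx1
    have hq2 := Finset.mem_Ioc.mp hq
    have hqpos : (0:ℝ) < q := by exact_mod_cast (by omega : 0 < q)
    push_cast at hx2
    refine Finset.mem_biUnion.mpr ⟨q, ?_, Finset.mem_image.mpr ⟨a, ?_, rfl⟩⟩
    · refine Finset.mem_filter.mpr ⟨hq, ?_⟩
      set m := round ((a:ℝ)/(q:ℝ)^k - x')
      have hx4 : |(a:ℝ)/(q:ℝ)^k - x' - m| < w := hx2
      refine ⟨a - m * q^k, ?_⟩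
      push_cast
      have e : x' * (q:ℝ)^k - ((a:ℝ) - m * (q:ℝ)^k) = -(((a:ℝ)/(q:ℝ)^k - x' - m) * (q:ℝ)^k) := by
        field_simp; ring
      rw [e, abs_neg, abs_mul, abs_of_pos (by positivity : (0:ℝ) < (q:ℝ)^k)]
      calc _ < w * (q:ℝ)^k := by gcongr
        _ ≤ w * (2*Q:ℝ)^k := by
          gcongr
          exact_mod_cast hq2.2
        _ = δ := by simp only [w, δ]; ring
    · refine Finset.mem_filter.mpr ⟨ha1, ?_⟩
      push_cast
      exact hx2
  have hc := (Finset.card_le_card hsub).trans Finset.card_biUnion_le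
  calc _ ≤ ∑ q ∈ AA Q k x' δ, (((G q).image (fun a : ℕ => (a : ℚ) / (q : ℚ)^k)).card : ℝ) := by
        exact_mod_cast hc
    _ ≤ ∑ q ∈ AA Q k x' δ, (3 * (2 * δ + 1)) := by
        apply Finset.sum_le_sum
        intro q hq
        have hq2 := Finset.mem_Ioc.mp (Finset.mem_filter.mp hq).1
        have : (((G q).image (fun a : ℕ => (a : ℚ) / (q : ℚ)^k)).card : ℝ) ≤ (G q).card := by
          exact_mod_cast Finset.card_image_le
        refine this.trans ((perq_card _ x' w hw.le h0 h1).trans ?_)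
        have : w * ((q^k : ℕ) : ℝ) ≤ δ := by
          push_cast
          calc _ ≤ w * (2*Q:ℝ)^k := by
                gcongr
                exact_mod_cast hq2.2
            _ = δ := by simp only [w, δ]; ring
        gcongr
    _ = _ := by rw [Finset.sum_const, nsmul_eq_mul]

/-- Bound for the number of admissible denominators. -/
lemma A_bound (j Q N q' a : ℕ) (hN : 0 < N) (hq1 : Q < q') (hq2 : q' ≤ 2 * Q)
    (ha : Nat.Coprime a q') (D : ℝ) (hD : 1 ≤ D)
    (hdiv : ∀ n : ℕ, n ≠ 0 → n ≤ 2^j * (2*Q)^(j+1) → ((2 * n.divisors.card : ℕ) : ℝ)^j ≤ D) :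
    ((AA Q (j+1) ((a:ℝ)/(q':ℝ)^(j+1)) ((2*Q:ℝ)^(j+1)/(2*N))).card : ℝ)^(2^j) ≤
      ((j + 1) + (2 * 2^(2*j+1) + 1) * 2^j) * D *
        ((2*Q:ℝ)^(2^j-1) + (2*Q:ℝ)^(2^j+(j+1))/N) := by
  set δ := ((2*Q:ℝ)^(j+1)/(2*N))
  have hNR : (0:ℝ) < N := by exact_mod_cast hN
  have hQ : 0 < Q := by omega
  have hQR : (1:ℝ) ≤ Q := by exact_mod_cast hQ
  have hδ : 0 ≤ δ := by positivity
  set r := q'^(j+1) with hr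
  have hrpos : 0 < r := by apply pow_pos; omega
  set AN := AA Q (j+1) ((a:ℝ)/(q':ℝ)^(j+1)) δ with hAN
  set A : Finset ℤ := AN.image (fun q : ℕ => (q:ℤ)) with hA
  have hAcard : A.card = AN.card := Finset.card_image_of_injective _ Nat.cast_injective
  have hAmem : ∀ x ∈ A, ((Q:ℤ) < x ∧ x ≤ 2 * Q) ∧ ∃ m : ℤ, |(a:ℝ)/r * (x:ℝ)^(j+1) - m| < δ := by
    intro x hx
    obtain ⟨q, hq, rfl⟩ := Finset.mem_image.mp hx
    obtain ⟨h1, m, h2⟩ := Finset.mem_filter.mp hq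
    have h3 := Finset.mem_Ioc.mp h1
    refine ⟨by omega, m, ?_⟩
    rw [hr]; push_cast; exact h2
  set I : Finset ℤ := Finset.Ioo (-(Q:ℤ)) Q
  have hIcard : I.card ≤ 2 * Q := by
    simp only [I, Int.card_Ioo]; omega
  set S : ℕ → Finset ℤ := fun i => (Finset.Icc (-(2^i * (2*Q)^(j+1) : ℤ)) (2^i * (2*Q)^(j+1))).filter
    (fun n : ℤ => ∃ m : ℤ, |(a:ℝ)/r * n - m| < 2^i * δ) with hSdef
  have hS : ∀ i, ∀ a ∈ S i, ∀ b ∈ S i, a - b ∈ S (i+1) := by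
    intro i x hx y hy
    obtain ⟨hx1, m, hm⟩ := Finset.mem_filter.mp hx
    obtain ⟨hy1, m', hm'⟩ := Finset.mem_filter.mp hy
    rw [Finset.mem_Icc] at hx1 hy1
    refine Finset.mem_filter.mpr ⟨?_, m - m', ?_⟩
    · rw [Finset.mem_Icc, pow_succ 2 i]
      constructor <;> linarith [hx1.1, hx1.2, hy1.1, hy1.2]
    · push_cast
      rw [abs_lt] at *
      rw [pow_succ 2 i]
      constructor <;> linarith [hm.1, hm.2, hm'.1, hm'.2]
  have hAL : A.card ≤ 2 * Q := by
    rw [hAcard]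
    refine (Finset.card_filter_le _ _).trans ?_
    rw [Nat.card_Ioc]; omega
  have hmain := weyl_count I (2*Q) hIcard S hS j (Polynomial.X^(j+1)) (Polynomial.natDegree_X_pow _)
    A hAL ?_ ?_ D (by linarith) ?_
  rotate_left
  · intro x hx y hy
    have h1 := (hAmem x hx).1
    have h2 := (hAmem y hy).1
    simp only [I, Finset.mem_Ioo]
    omega
  · intro x hx
    obtain ⟨⟨h1, h2⟩, m, hm⟩ := hAmem x hx
    have hx0 : 0 ≤ x := by omega
    simp only [Polynomial.eval_pow, Polynomial.eval_X]
    refine Finset.mem_filter.mpr ⟨?_, m, ?_⟩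
    · rw [Finset.mem_Icc, pow_zero, one_mul]
      have hp : x^(j+1) ≤ (2*(Q:ℤ))^(j+1) := pow_le_pow_left₀ hx0 h2 _
      have : 0 ≤ x^(j+1) := by positivity
      exact ⟨by linarith, hp⟩
    · push_cast; rw [pow_zero, one_mul]; exact hm
  · intro n hn hn0
    apply hdiv _ (by simpa using hn0)
    have h1 := Finset.mem_Icc.mp (Finset.mem_filter.mp hn).1
    have : |n| ≤ (2:ℤ)^j * (2*Q)^(j+1) := abs_le.mpr h1
    zify
    exact this
  have hScard : ((S j).card : ℝ) ≤ (2 * (2^(2*j+1) : ℕ) + 1) * (2 * (2^j * δ * r) + 1) := by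
    apply S_card r a (2^(2*j+1)) hrpos (Nat.Coprime.pow_right _ ha) _ _ _ (by positivity)
    rw [hr]
    push_cast
    calc (2:ℤ)^j * (2*Q)^(j+1) = 2^(2*j+1) * (Q:ℤ)^(j+1) := by rw [mul_pow]; ring
      _ ≤ _ := by gcongr
  rw [hAcard] at hmain
  set L : ℝ := 2 * Q with hL
  have hL1 : 1 ≤ L := by linarith
  push_cast at hmain hScard
  rw [← hL] at hmain
  have hrL : (r:ℝ) ≤ L^(j+1) := by
    rw [hr, hL]; push_cast; gcongr; exact_mod_cast hq2
  have hS2 : ((S j).card : ℝ) ≤ (2 * 2^(2*j+1) + 1) * 2^j * (L^(2*(j+1))/N + 1) := by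
    have h2j : (1:ℝ) ≤ 2^j := one_le_pow₀ (by norm_num)
    calc _ ≤ _ := hScard
      _ ≤ (2 * 2^(2*j+1) + 1) * (2 * (2^j * δ * L^(j+1)) + 2^j) := by gcongr
      _ = _ := by simp only [δ]; field_simp; ring
  have hLpos : 0 < L := by linarith
  have e1 : L^(2^j+j) = L^(2^j-1) * L^(j+1) := by
    rw [← pow_add]; congr 1; have := Nat.two_pow_pos j; omega
  have e2 : L^(2^j) ≤ L^(2^j-1) * L^(j+1) := by
    rw [← e1]; exact pow_le_pow_right₀ hL1 (by omega)
  have e3 : L^(2^j) * (L^(2*(j+1))/N) = L^(2^j+(j+1))/N * L^(j+1) := by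
    field_simp; ring
  set c : ℝ := (2 * 2^(2*j+1) + 1) * 2^j with hc
  have hc0 : 0 ≤ c := by positivity
  set Z := L^(2^j-1)
  set Y := L^(2^j+(j+1))/N
  have hY : 0 ≤ Y := by positivity
  have hZ : 0 ≤ Z := by positivity
  refine le_of_mul_le_mul_right ?_ (by positivity : 0 < L^(j+1))
  calc _ ≤ _ := hmain
    _ ≤ (j+1) * (Z * L^(j+1)) + L^(2^j) * (c * (L^(2*(j+1))/N + 1) * D) := by rw [e1]; gcongr
    _ = (j+1) * (Z * L^(j+1)) + c * D * (L^(2^j) * (L^(2*(j+1))/N)) + c * D * L^(2^j) := by ring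
    _ ≤ (j+1) * D * ((Z + Y) * L^(j+1)) + c * D * (Y * L^(j+1)) + c * D * (Z * L^(j+1)) := by
        rw [e3]
        have : ((j:ℝ)+1) * (Z * L^(j+1)) ≤ (j+1) * D * ((Z + Y) * L^(j+1)) := by
          rw [mul_assoc]
          apply mul_le_mul_of_nonneg_left _ (by positivity)
          calc Z * L^(j+1) ≤ 1 * ((Z+Y) * L^(j+1)) := by
                rw [one_mul]; gcongr; linarith
            _ ≤ _ := by gcongr
        have h2 : c * D * L^(2^j) ≤ c * D * (Z * L^(j+1)) := by gcongr
        linarith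
    _ = _ := by ring

lemma final_alg (κ k Q N : ℕ) (hκ : 0 < κ) (hN : 0 < N) (M E c : ℝ) (hE : 1 ≤ E)
    (hc : 1 ≤ c)
    (h : M^κ ≤ c * E * ((2*Q:ℝ)^(κ-1) + (2*Q:ℝ)^(κ+k)/N)) :
    M ≤ c * 2^(κ+k) * (((Q:ℝ) ^ (((κ:ℝ) - 1)/(κ:ℝ)) +
      (Q:ℝ) ^ (((κ:ℝ) + k)/(κ:ℝ)) / (N:ℝ) ^ ((1:ℝ)/(κ:ℝ))) * E) := by
  have hκR : (0:ℝ) < κ := by exact_mod_cast hκ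
  have hNR : (0:ℝ) < N := by exact_mod_cast hN
  set u := (Q:ℝ) ^ (((κ:ℝ) - 1)/(κ:ℝ))
  set v := (Q:ℝ) ^ (((κ:ℝ) + k)/(κ:ℝ)) / (N:ℝ) ^ ((1:ℝ)/(κ:ℝ))
  have hu0 : 0 ≤ u := by positivity
  have hv0 : 0 ≤ v := by positivity
  have hu : u^κ = (Q:ℝ)^(κ-1) := by
    simp only [u]
    rw [← Real.rpow_natCast, ← Real.rpow_mul (by positivity), div_mul_cancel₀ _ hκR.ne',
      ← Real.rpow_natCast, Nat.cast_sub hκ, Nat.cast_one]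
  have hv : v^κ = (Q:ℝ)^(κ+k)/N := by
    simp only [v]
    rw [div_pow, ← Real.rpow_natCast, ← Real.rpow_mul (by positivity), div_mul_cancel₀ _ hκR.ne',
      ← Real.rpow_natCast ((N:ℝ)^_), ← Real.rpow_mul (by positivity), div_mul_cancel₀ _ hκR.ne',
      Real.rpow_one, ← Real.rpow_natCast, Nat.cast_add]
  have huv : u^κ + v^κ ≤ (u+v)^κ := pow_add_pow_le hu0 hv0 hκ.ne'
  set c' : ℝ := c * 2^(κ+k)
  have h2 : (1:ℝ) ≤ 2^(κ+k) := one_le_pow₀ (by norm_num)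
  have hc' : 1 ≤ c' := one_le_mul_of_one_le_of_one_le hc h2
  refine le_of_pow_le_pow_left₀ hκ.ne' (by positivity) ?_
  calc M^κ ≤ _ := h
    _ ≤ c * E * (2^(κ+k) * (Q:ℝ)^(κ-1) + 2^(κ+k) * ((Q:ℝ)^(κ+k)/N)) := by
        rw [mul_pow, mul_pow, mul_div_assoc]
        gcongr
        · norm_num
        · omega
    _ = c' * ((u^κ + v^κ) * E) := by rw [hu, hv]; simp only [c']; ring
    _ ≤ c'^κ * ((u+v)^κ * E^κ) := by
        gcongr
        · exact le_self_pow₀ hc' hκ.ne'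
        · exact le_self_pow₀ hE hκ.ne'
    _ = _ := by rw [← mul_pow, ← mul_pow]

theorem stmt3 (k : ℕ) (hk : 2 ≤ k) (κ : ℕ) (hκ : κ = 2^(k-1)) :
    ∀ ε : ℝ, ε > 0 → ∃ C : ℝ, C > 0 ∧ ∀ Q N : ℕ, 0 < Q → 0 < N →
    (MQNk Q N k : ℝ) ≤ C * ((Q:ℝ)^(k+1) / (N:ℝ) +
      ((Q:ℝ) ^ (((κ:ℝ) - 1)/(κ:ℝ)) + (Q:ℝ) ^ (((κ:ℝ) + k)/(κ:ℝ)) / (N:ℝ) ^ ((1:ℝ)/(κ:ℝ)))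
        * (N:ℝ)^ε) := by
  intro ε hε
  obtain ⟨j, rfl⟩ : ∃ j, k = j + 1 := ⟨k-1, by omega⟩
  rw [Nat.add_sub_cancel] at hκ
  have hκpos : 0 < κ := by rw [hκ]; positivity
  obtain ⟨c0, hc0, hdiv⟩ := divisor_bound (ε/(j+1)) (by positivity)
  set η := ε/(j+1) with hη
  have hηpos : 0 < η := by positivity
  set c1 : ℝ := (2 * (c0 * ((2:ℝ)^j)^η))^j with hc1
  have h2j : (1:ℝ) ≤ ((2:ℝ)^j)^η := Real.one_le_rpow (one_le_pow₀ (by norm_num)) hηpos.le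
  have hc1' : 1 ≤ c1 := by
    apply one_le_pow₀
    nlinarith
  set c2 : ℝ := (j + 1) + (2 * 2^(2*j+1) + 1) * 2^j with hc2
  have hc2' : 1 ≤ c2 := by
    have : (0:ℝ) ≤ (2 * 2^(2*j+1) + 1) * 2^j := by positivity
    have : (0:ℝ) ≤ j := by positivity
    linarith
  set c3 : ℝ := c2 * c1 * 2^(κ+(j+1)) with hc3
  have hc3' : 0 < c3 := by positivity
  refine ⟨6 * 2^(j+1) + 6 * c3, by positivity, ?_⟩
  intro Q N hQ hN
  have hQR : (0:ℝ) < Q := by exact_mod_cast hQ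
  have hNR : (0:ℝ) < N := by exact_mod_cast hN
  have hN1 : (1:ℝ) ≤ N := by exact_mod_cast hN
  set X := (Q:ℝ)^(j+1+1) / (N:ℝ) with hX
  set Y := ((Q:ℝ) ^ (((κ:ℝ) - 1)/(κ:ℝ)) + (Q:ℝ) ^ (((κ:ℝ) + (j+1 : ℕ))/(κ:ℝ)) /
    (N:ℝ) ^ ((1:ℝ)/(κ:ℝ))) * (N:ℝ)^ε with hY
  have hX0 : 0 ≤ X := by positivity
  have hY0 : 0 ≤ Y := by positivity
  have key : ∀ x' ∈ SQk Q (j+1),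
      (((SQk Q (j+1)).filter (fun x : ℚ => dist01 ((x:ℝ) - (x':ℝ)) < 1/(2*(N:ℝ)))).card : ℝ) ≤
        (6 * 2^(j+1) + 6 * c3) * (X + Y) := by
    intro x' hx'
    obtain ⟨q', hq', a, ha, hcop, hxe⟩ := (mem_SQk _ _ _).mp hx'
    rw [Finset.mem_Ioc] at hq'
    rw [Finset.mem_Ico] at ha
    have hq'R : (0:ℝ) < q' := by exact_mod_cast (by omega : 0 < q')
    have hxR : (x':ℝ) = (a:ℝ)/(q':ℝ)^(j+1) := by rw [← hxe]; push_cast; rfl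
    have hx0 : 0 ≤ (x':ℝ) := by rw [hxR]; positivity
    have hx1 : (x':ℝ) ≤ 1 := by
      rw [hxR, div_le_one (by positivity)]
      exact_mod_cast ha.2.le
    have hcount := count_le Q N (j+1) hN x' hx0 hx1
    set δ := ((2*Q:ℝ)^(j+1)/(2*N)) with hδ
    have hδ0 : 0 < δ := by positivity
    rcases le_or_gt N ((2*Q)^(j+1)) with hcase | hcase
    · have hδ1 : 1 ≤ 2 * δ := by
        have : (N:ℝ) ≤ (2*Q:ℝ)^(j+1) := by exact_mod_cast hcase
        rw [hδ, mul_div_assoc', le_div_iff₀ (by positivity)]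
        linarith
      have hAQ : ((AA Q (j+1) x' δ).card : ℝ) ≤ Q := by
        have : (AA Q (j+1) x' δ).card ≤ Q := by
          refine (Finset.card_filter_le _ _).trans ?_
          rw [Nat.card_Ioc]; omega
        exact_mod_cast this
      calc _ ≤ _ := hcount
        _ ≤ Q * (3 * (2 * δ + 2 * δ)) := by gcongr
        _ = 6 * 2^(j+1) * X := by rw [hδ, hX, mul_pow]; field_simp; ring
        _ ≤ (6 * 2^(j+1) + 6 * c3) * (X + Y) := by
          apply mul_le_mul <;> first | positivity | linarith
    · have hcR : (2*Q:ℝ)^(j+1) ≤ N := by exact_mod_cast hcase.le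
      have hδ1 : 2 * δ ≤ 1 := by
        rw [hδ, mul_div_assoc', div_le_iff₀ (by positivity)]
        linarith
      have hNε : 1 ≤ (N:ℝ)^ε := Real.one_le_rpow hN1 hε.le
      have hA := A_bound j Q N q' a hN hq'.1 hq'.2 hcop (c1 * (N:ℝ)^ε)
        (one_le_mul_of_one_le_of_one_le hc1' hNε) ?_
      · rw [← hxR, ← hδ, ← hc2, ← hκ, ← mul_assoc] at hA
        have hfin := final_alg κ (j+1) Q N hκpos hN _ _ (c2 * c1) hNε
          (one_le_mul_of_one_le_of_one_le hc2' hc1') hA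
        rw [← hc3, ← hY] at hfin
        calc _ ≤ _ := hcount
          _ ≤ c3 * Y * (3 * (1 + 1)) := by gcongr
          _ = 6 * c3 * Y := by ring
          _ ≤ _ := by
            have : (0:ℝ) < 6 * 2^(j+1) := by positivity
            apply mul_le_mul <;> first | positivity | linarith
      · intro n hn0 hn
        have hnR : (n:ℝ) ≤ 2^j * N := by
          calc (n:ℝ) ≤ 2^j * (2*Q)^(j+1) := by exact_mod_cast hn
            _ ≤ _ := by gcongr
        have hd : (n.divisors.card : ℝ) ≤ c0 * (((2:ℝ)^j)^η * (N:ℝ)^η) := by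
          refine (hdiv n hn0).trans ?_
          rw [← Real.mul_rpow (by positivity) (by positivity)]
          gcongr
        push_cast
        calc (2 * (n.divisors.card : ℝ))^j ≤ (2 * (c0 * (((2:ℝ)^j)^η * (N:ℝ)^η)))^j := by gcongr
          _ = c1 * ((N:ℝ)^η)^j := by rw [hc1, ← mul_pow]; ring
          _ ≤ c1 * (N:ℝ)^ε := by
            gcongr
            rw [← Real.rpow_natCast, ← Real.rpow_mul (by positivity)]
            apply Real.rpow_le_rpow_of_exponent_le hN1
            rw [hη, div_mul_eq_mul_div, div_le_iff₀ (by positivity)]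
            nlinarith
  have hfl : MQNk Q N (j+1) ≤ ⌊(6 * 2^(j+1) + 6 * c3) * (X + Y)⌋₊ :=
    MQNk_le _ _ _ _ (fun x' hx' => Nat.le_floor (key x' hx'))
  exact (Nat.cast_le.mpr hfl).trans (Nat.floor_le (by positivity))
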